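/- arXiv:1909.10873 — 5 statements merged into one kernel-verified Lean document; each statement's English description precedes it below -/
import Mathlib

section
/- Γ^k(M₀) → 0 as k → ∞ for every positive semidefinite d×d matrix M₀ if, and only if, the LMI condition holds. -/
open Matrix Filter

namespace Stmt4Aux

variable {d L : ℕ}

/-- The map `Γ`. -/
def gam (A0 : Matrix (Fin d) (Fin d) ℝ) (A : Fin L → Matrix (Fin d) (Fin d) ℝ)
    (s : Fin L → ℝ) (X : Matrix (Fin d) (Fin d) ℝ) : Matrix (Fin d) (Fin d) ℝ :=
  A0 * X * A0ᵀ + ∑ i, s i • (A i * X * (A i)ᵀ)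

/-- The adjoint of `Γ`. -/
def gamT (A0 : Matrix (Fin d) (Fin d) ℝ) (A : Fin L → Matrix (Fin d) (Fin d) ℝ)
    (s : Fin L → ℝ) (X : Matrix (Fin d) (Fin d) ℝ) : Matrix (Fin d) (Fin d) ℝ :=
  A0ᵀ * X * A0 + ∑ i, s i • ((A i)ᵀ * X * A i)

lemma gamT_eq (A0 : Matrix (Fin d) (Fin d) ℝ) (A : Fin L → Matrix (Fin d) (Fin d) ℝ)
    (s : Fin L → ℝ) : gamT A0 A s = gam A0ᵀ (fun i => (A i)ᵀ) s := by
  funext X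
  simp [gam, gamT]

lemma gam_posSemidef (A0 : Matrix (Fin d) (Fin d) ℝ) (A : Fin L → Matrix (Fin d) (Fin d) ℝ)
    (s : Fin L → ℝ) (hs : ∀ i, 0 ≤ s i) {X : Matrix (Fin d) (Fin d) ℝ} (hX : X.PosSemidef) :
    (gam A0 A s X).PosSemidef := by
  unfold gam
  refine PosSemidef.add ?_ (posSemidef_sum _ fun i _ => PosSemidef.smul ?_ (hs i))
  · simpa using hX.mul_mul_conjTranspose_same A0
  · simpa using hX.mul_mul_conjTranspose_same (A i)

lemma iter_posSemidef (A0 : Matrix (Fin d) (Fin d) ℝ) (A : Fin L → Matrix (Fin d) (Fin d) ℝ)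
    (s : Fin L → ℝ) (hs : ∀ i, 0 ≤ s i) {X : Matrix (Fin d) (Fin d) ℝ} (hX : X.PosSemidef)
    (k : ℕ) : ((gam A0 A s)^[k] X).PosSemidef := by
  induction k with
  | zero => simpa using hX
  | succ k ih =>
    rw [Function.iterate_succ_apply']
    exact gam_posSemidef A0 A s hs ih

lemma trace_adj (A0 : Matrix (Fin d) (Fin d) ℝ) (A : Fin L → Matrix (Fin d) (Fin d) ℝ)
    (s : Fin L → ℝ) (P X : Matrix (Fin d) (Fin d) ℝ) :
    (P * gam A0 A s X).trace = (gamT A0 A s P * X).trace := by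
  have key : ∀ B : Matrix (Fin d) (Fin d) ℝ,
      (P * (B * X * Bᵀ)).trace = (Bᵀ * P * B * X).trace := by
    intro B
    rw [← Matrix.mul_assoc, Matrix.trace_mul_comm]
    simp only [Matrix.mul_assoc]
  simp [gam, gamT, Matrix.mul_add, Matrix.add_mul, Matrix.mul_sum, Matrix.sum_mul,
    Matrix.trace_sum, key]

lemma trace_adj_iter (A0 : Matrix (Fin d) (Fin d) ℝ) (A : Fin L → Matrix (Fin d) (Fin d) ℝ)
    (s : Fin L → ℝ) (k : ℕ) (P X : Matrix (Fin d) (Fin d) ℝ) :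
    (P * (gam A0 A s)^[k] X).trace = ((gamT A0 A s)^[k] P * X).trace := by
  induction k generalizing P with
  | zero => simp
  | succ k ih =>
    rw [Function.iterate_succ_apply', trace_adj, ih, Function.iterate_succ_apply]

lemma exists_factor {S : Matrix (Fin d) (Fin d) ℝ} (hS : S.PosSemidef) :
    ∃ B : Matrix (Fin d) (Fin d) ℝ, S = Bᵀ * B := by
  obtain ⟨B, hB⟩ : ∃ B : Matrix (Fin d) (Fin d) ℝ, S = Bᴴ * B := by
    open scoped MatrixOrder in
    exact CStarAlgebra.nonneg_iff_eq_star_mul_self.mp hS.nonneg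
  exact ⟨B, by simpa using hB⟩

lemma entry_le {S : Matrix (Fin d) (Fin d) ℝ} (hS : S.PosSemidef) (i j : Fin d) :
    |S i j| ≤ S.trace := by
  obtain ⟨B, rfl⟩ := exists_factor hS
  have hdiag : ∀ l, (Bᵀ * B) l l ≤ (Bᵀ * B).trace := fun l => by
    rw [Matrix.trace]
    exact Finset.single_le_sum (f := fun l => (Bᵀ * B).diag l)
      (fun l _ => hS.diag_nonneg) (Finset.mem_univ l)
  have hi := hdiag i
  have hj := hdiag j
  have e1 : 0 ≤ (Bᵀ * B) i i + (Bᵀ * B) j j - 2 * (Bᵀ * B) i j := by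
    have : (Bᵀ * B) i i + (Bᵀ * B) j j - 2 * (Bᵀ * B) i j = ∑ k, (B k i - B k j) ^ 2 := by
      simp only [Matrix.mul_apply, Matrix.transpose_apply, Finset.mul_sum,
        ← Finset.sum_add_distrib, ← Finset.sum_sub_distrib]
      exact Finset.sum_congr rfl fun k _ => by ring
    rw [this]; positivity
  have e2 : 0 ≤ (Bᵀ * B) i i + (Bᵀ * B) j j + 2 * (Bᵀ * B) i j := by
    have : (Bᵀ * B) i i + (Bᵀ * B) j j + 2 * (Bᵀ * B) i j = ∑ k, (B k i + B k j) ^ 2 := by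
      simp only [Matrix.mul_apply, Matrix.transpose_apply, Finset.mul_sum,
        ← Finset.sum_add_distrib]
      exact Finset.sum_congr rfl fun k _ => by ring
    rw [this]; positivity
  rw [abs_le]
  constructor <;> linarith

lemma one_sub_posDef {S : Matrix (Fin d) (Fin d) ℝ} (hS : S.PosSemidef) (ht : S.trace < 1) :
    (1 - S).PosDef := by
  refine PosDef.of_dotProduct_mulVec_pos (isHermitian_one.sub hS.isHermitian) fun x hx => ?_
  obtain ⟨B, rfl⟩ := exists_factor hS
  have hxx : 0 < x ⬝ᵥ x := by
    have := dotProduct_star_self_pos_iff (v := x).mpr hx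
    simpa using this
  have h1 : x ⬝ᵥ ((Bᵀ * B) *ᵥ x) = ∑ i, (∑ j, B i j * x j) ^ 2 := by
    rw [← Matrix.mulVec_mulVec, Matrix.dotProduct_mulVec, Matrix.vecMul_transpose]
    simp [dotProduct, Matrix.mulVec, sq]
  have h2 : ∑ i, (∑ j, B i j * x j) ^ 2 ≤ (Bᵀ * B).trace * (x ⬝ᵥ x) := by
    have : (Bᵀ * B).trace = ∑ i, ∑ j, B i j ^ 2 := by
      rw [Finset.sum_comm]
      simp [Matrix.trace, Matrix.mul_apply, sq]
    rw [this, Finset.sum_mul]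
    refine Finset.sum_le_sum fun i _ => ?_
    have := Finset.sum_mul_sq_le_sq_mul_sq Finset.univ (fun j => B i j) x
    simpa [dotProduct, sq] using this
  have h3 : star x ⬝ᵥ ((1 - Bᵀ * B) *ᵥ x) = x ⬝ᵥ x - x ⬝ᵥ ((Bᵀ * B) *ᵥ x) := by
    simp [Matrix.sub_mulVec, dotProduct_sub]
  rw [h3, h1]
  nlinarith

lemma tendsto_of_trace {u : ℕ → Matrix (Fin d) (Fin d) ℝ} (hu : ∀ k, (u k).PosSemidef)
    (ht : Tendsto (fun k => (u k).trace) atTop (nhds 0)) : Tendsto u atTop (nhds 0) := by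
  refine tendsto_pi_nhds.mpr fun i => tendsto_pi_nhds.mpr fun j => ?_
  exact squeeze_zero_norm (fun k => entry_le (hu k) i j) ht

lemma tendsto_of_trace_mul {Q : Matrix (Fin d) (Fin d) ℝ} (hQ : Q.PosDef)
    {u : ℕ → Matrix (Fin d) (Fin d) ℝ} (hu : ∀ k, (u k).PosSemidef)
    (ht : Tendsto (fun k => (Q * u k).trace) atTop (nhds 0)) : Tendsto u atTop (nhds 0) := by
  obtain ⟨B, hB⟩ := exists_factor hQ.posSemidef
  have hBu : IsUnit B.det := by
    have h := (Matrix.isUnit_iff_isUnit_det _).mp hQ.isUnit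
    rw [hB, Matrix.det_mul] at h
    exact isUnit_of_mul_isUnit_right h
  have h1 : Tendsto (fun k => B * u k * Bᵀ) atTop (nhds 0) := by
    refine tendsto_of_trace (fun k => by simpa using (hu k).mul_mul_conjTranspose_same B) ?_
    refine ht.congr fun k => ?_
    rw [hB, Matrix.trace_mul_comm (B * u k), Matrix.mul_assoc Bᵀ B, ]
  have hc : Continuous fun Y : Matrix (Fin d) (Fin d) ℝ => B⁻¹ * Y * (B⁻¹)ᵀ := by fun_prop
  have h2 := (hc.tendsto 0).comp h1
  simp only [Matrix.mul_zero, Matrix.zero_mul] at h2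
  refine h2.congr fun k => ?_
  have e : Bᵀ * (B⁻¹)ᵀ = 1 := by
    rw [← Matrix.transpose_mul, Matrix.nonsing_inv_mul _ hBu, Matrix.transpose_one]
  simp only [Function.comp_apply]
  calc B⁻¹ * (B * u k * Bᵀ) * (B⁻¹)ᵀ = (B⁻¹ * B) * u k * (Bᵀ * (B⁻¹)ᵀ) := by
        simp only [Matrix.mul_assoc]
    _ = u k := by rw [e, Matrix.nonsing_inv_mul _ hBu, Matrix.one_mul, Matrix.mul_one]

lemma trace_mul_nonneg {Q X : Matrix (Fin d) (Fin d) ℝ} (hQ : Q.PosSemidef)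
    (hX : X.PosSemidef) : 0 ≤ (Q * X).trace := by
  obtain ⟨B, rfl⟩ := exists_factor hQ
  have h : (B * X * Bᵀ).PosSemidef := by simpa using hX.mul_mul_conjTranspose_same B
  have := h.trace_nonneg
  rwa [Matrix.trace_mul_comm, ← Matrix.mul_assoc] at this

lemma gamT_sum (A0 : Matrix (Fin d) (Fin d) ℝ) (A : Fin L → Matrix (Fin d) (Fin d) ℝ)
    (s : Fin L → ℝ) (f : ℕ → Matrix (Fin d) (Fin d) ℝ) (n : ℕ) :
    gamT A0 A s (∑ k ∈ Finset.range n, f k) = ∑ k ∈ Finset.range n, gamT A0 A s (f k) := by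
  simp only [gamT, Matrix.mul_sum, Matrix.sum_mul, Finset.smul_sum, Finset.sum_add_distrib]
  rw [Finset.sum_comm]

end Stmt4Aux

/-- With `Γ(X) = Ã₀ X Ã₀ᵀ + Σᵢ σᵢ² Ãᵢ X Ãᵢᵀ`, we have
`Γ^k(M₀) → 0` for every positive semidefinite `M₀` if, and only if, there exists a
symmetric positive definite `P` with `Ã₀ᵀ P Ã₀ − P + Σᵢ σᵢ² Ãᵢᵀ P Ãᵢ` negative definite. -/
theorem stmt4 {d L : ℕ} (hd : 1 ≤ d)
    (A0 : Matrix (Fin d) (Fin d) ℝ) (Amat : Fin L → Matrix (Fin d) (Fin d) ℝ)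
    (σ2 : Fin L → ℝ) (hσ2 : ∀ i, 0 ≤ σ2 i) :
    (∀ M0 : Matrix (Fin d) (Fin d) ℝ, M0.PosSemidef →
      Tendsto (fun k => (fun X => A0 * X * A0ᵀ + ∑ i, σ2 i • (Amat i * X * (Amat i)ᵀ))^[k] M0)
        atTop (nhds 0)) ↔
    ∃ P : Matrix (Fin d) (Fin d) ℝ, P.PosDef ∧
      (-(A0ᵀ * P * A0 - P + ∑ i, σ2 i • ((Amat i)ᵀ * P * Amat i))).PosDef := by
  have hdef : (fun X => A0 * X * A0ᵀ + ∑ i, σ2 i • (Amat i * X * (Amat i)ᵀ))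
      = Stmt4Aux.gam A0 Amat σ2 := rfl
  rw [hdef]
  have hneg : ∀ P : Matrix (Fin d) (Fin d) ℝ,
      -(A0ᵀ * P * A0 - P + ∑ i, σ2 i • ((Amat i)ᵀ * P * Amat i))
        = P - Stmt4Aux.gamT A0 Amat σ2 P := by
    intro P
    unfold Stmt4Aux.gamT
    abel
  simp only [hneg]
  constructor
  · intro h
    have h1 := h 1 PosSemidef.one
    have hc : Continuous fun Y : Matrix (Fin d) (Fin d) ℝ => Y.trace := by fun_prop
    have h2 := (hc.tendsto 0).comp h1
    rw [Matrix.trace_zero] at h2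
    obtain ⟨n, hn⟩ := ((h2.eventually_lt_const one_pos).and (eventually_ge_atTop 1)).exists
    obtain ⟨hn, hn1⟩ := hn
    have hpsd : ∀ k, ((Stmt4Aux.gamT A0 Amat σ2)^[k] 1).PosSemidef := fun k => by
      rw [Stmt4Aux.gamT_eq]
      exact Stmt4Aux.iter_posSemidef _ _ _ hσ2 PosSemidef.one k
    have htr : ((Stmt4Aux.gamT A0 Amat σ2)^[n] 1).trace < 1 := by
      have := Stmt4Aux.trace_adj_iter A0 Amat σ2 n 1 1
      rw [Matrix.one_mul, Matrix.mul_one] at this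
      rw [← this]
      exact hn
    refine ⟨∑ k ∈ Finset.range n, (Stmt4Aux.gamT A0 Amat σ2)^[k] 1, ?_, ?_⟩
    · obtain ⟨m, rfl⟩ : ∃ m, n = m + 1 := ⟨n - 1, by omega⟩
      rw [Finset.sum_range_succ']
      exact PosDef.posSemidef_add (posSemidef_sum _ fun k _ => hpsd _) PosDef.one
    · have e : ∑ k ∈ Finset.range n, (Stmt4Aux.gamT A0 Amat σ2)^[k] 1
          - Stmt4Aux.gamT A0 Amat σ2 (∑ k ∈ Finset.range n, (Stmt4Aux.gamT A0 Amat σ2)^[k] 1)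
          = 1 - (Stmt4Aux.gamT A0 Amat σ2)^[n] 1 := by
        rw [Stmt4Aux.gamT_sum, ← Finset.sum_sub_distrib]
        simp only [← Function.iterate_succ_apply']
        exact Finset.sum_range_sub' (fun k => (Stmt4Aux.gamT A0 Amat σ2)^[k] 1) n
      rw [e]
      exact Stmt4Aux.one_sub_posDef (hpsd n) htr
  · rintro ⟨P, hP, hQ⟩ M0 hM0
    have hu := fun k => Stmt4Aux.iter_posSemidef A0 Amat σ2 hσ2 hM0 k
    refine Stmt4Aux.tendsto_of_trace_mul hQ hu ?_
    have hstep : ∀ k, ((P - Stmt4Aux.gamT A0 Amat σ2 P) * (Stmt4Aux.gam A0 Amat σ2)^[k] M0).trace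
        = (P * (Stmt4Aux.gam A0 Amat σ2)^[k] M0).trace
          - (P * (Stmt4Aux.gam A0 Amat σ2)^[k + 1] M0).trace := fun k => by
      rw [Function.iterate_succ_apply', Stmt4Aux.trace_adj, Matrix.sub_mul, Matrix.trace_sub]
    refine (summable_of_sum_range_le (c := (P * M0).trace)
      (fun k => Stmt4Aux.trace_mul_nonneg hQ.posSemidef (hu k)) fun n => ?_).tendsto_atTop_zero
    simp only [hstep]
    rw [Finset.sum_range_sub' (fun k => (P * (Stmt4Aux.gam A0 Amat σ2)^[k] M0).trace)]
    have := Stmt4Aux.trace_mul_nonneg hP.posSemidef (hu n)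
    simp only [Function.iterate_zero, id]
    linarith
end

section
/- Let F be a finite set, σ : ℕ → F a switching signal, E a set, x : ℕ → E a sequence, and V : F → E → ℝ a family of nonnegative functions. Let α ∈ (0,1) and μ ≥ 1 and assume: (i) for every k, V_{σ(k)}(x(k+1)) ≤ (1−α)·V_{σ(k)}(x(k)); and (ii) for every k ≥ 1 with σ(k) ≠ σ(k−1), V_{σ(k)}(x(k)) ≤ μ·V_{σ(k−1)}(x(k)). Then for every k, V_{σ(k)}(x(k)) ≤ (1−α)^k · μ^{N_σ(0,k)} · V_{σ(0)}(x(0)), where N_σ(0,k) is the number of indices j with 1 ≤ j ≤ k and σ(j) ≠ σ(j−1). -/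
/-- `N_σ(s, e)`: the number of switches of `σ` in the interval `(s, e]`, i.e. the number
of indices `k` with `s < k ≤ e` and `σ(k) ≠ σ(k−1)`. -/
def Nswitch {F : Type*} [DecidableEq F] (σ : ℕ → F) (s e : ℕ) : ℕ :=
  ((Finset.Ioc s e).filter fun k => σ k ≠ σ (k - 1)).card

/-- If the multiple Lyapunov functions `V_i ≥ 0` decay by a factor
`1−α` within each mode and jump by at most a factor `μ` at each switch, then
`V_{σ(k)}(x(k)) ≤ (1−α)^k · μ^{N_σ(0,k)} · V_{σ(0)}(x(0))` for every `k`. -/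
theorem stmt10 {F : Type*} [Fintype F] [DecidableEq F] {E : Type*}
    (σ : ℕ → F) (x : ℕ → E) (V : F → E → ℝ)
    (hV : ∀ i e, 0 ≤ V i e)
    (α μ : ℝ) (hα : α ∈ Set.Ioo (0 : ℝ) 1) (hμ : 1 ≤ μ)
    (hdecay : ∀ k, V (σ k) (x (k + 1)) ≤ (1 - α) * V (σ k) (x k))
    (hjump : ∀ k, 1 ≤ k → σ k ≠ σ (k - 1) → V (σ k) (x k) ≤ μ * V (σ (k - 1)) (x k)) :
    ∀ k, V (σ k) (x k) ≤ (1 - α) ^ k * μ ^ (Nswitch σ 0 k) * V (σ 0) (x 0) := by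
  intro k
  induction k with
  | zero => simp [Nswitch]
  | succ k ih =>
    have hα' : 0 ≤ 1 - α := by linarith [hα.2]
    have h1 : V (σ k) (x (k + 1)) ≤
        (1 - α) ^ (k + 1) * μ ^ (Nswitch σ 0 k) * V (σ 0) (x 0) := by
      calc V (σ k) (x (k + 1)) ≤ (1 - α) * V (σ k) (x k) := hdecay k
        _ ≤ (1 - α) * ((1 - α) ^ k * μ ^ (Nswitch σ 0 k) * V (σ 0) (x 0)) :=
          mul_le_mul_of_nonneg_left ih hα'
        _ = _ := by ring
    have hI : Finset.Ioc 0 (k + 1) = insert (k + 1) (Finset.Ioc 0 k) := by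
      ext j
      simp only [Finset.mem_Ioc, Finset.mem_insert]
      omega
    by_cases h : σ (k + 1) = σ k
    · have hN : Nswitch σ 0 (k + 1) = Nswitch σ 0 k := by
        unfold Nswitch
        rw [hI, Finset.filter_insert, if_neg (by simpa using h)]
      rw [hN, h]
      exact h1
    · have hN : Nswitch σ 0 (k + 1) = Nswitch σ 0 k + 1 := by
        unfold Nswitch
        rw [hI, Finset.filter_insert, if_pos (by simpa using h),
          Finset.card_insert_of_notMem (by simp)]
      have h2 := hjump (k + 1) (by omega) (by simpa using h)
      rw [Nat.add_sub_cancel] at h2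
      rw [hN]
      calc V (σ (k + 1)) (x (k + 1)) ≤ μ * V (σ k) (x (k + 1)) := h2
        _ ≤ μ * ((1 - α) ^ (k + 1) * μ ^ (Nswitch σ 0 k) * V (σ 0) (x 0)) :=
          mul_le_mul_of_nonneg_left h1 (by linarith)
        _ = _ := by ring
end

section
/- Let F be a finite set, σ : ℕ → F a switching signal, E a set, x : ℕ → E a sequence, and V : F → E → ℝ a family of nonnegative functions. Let α ∈ (0,1), μ > 1, N₀ > 0 and τ_a > −(ln μ)/ln(1−α), and assume: (i) for every k, V_{σ(k)}(x(k+1)) ≤ (1−α)·V_{σ(k)}(x(k)); (ii) for every k ≥ 1 with σ(k) ≠ σ(k−1), V_{σ(k)}(x(k)) ≤ μ·V_{σ(k−1)}(x(k)); and (iii) σ has average dwell time τ_a with chatter bound N₀. Then λ := (1−α)·μ^{1/τ_a} < 1, and for every k, V_{σ(k)}(x(k)) ≤ μ^{N₀} · λ^k · V_{σ(0)}(x(0)); in particular V_{σ(k)}(x(k)) → 0 exponentially (global exponential stability). -/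
/-- Under the multiple-Lyapunov-function conditions (decay factor
`1−α` within modes, jump factor `μ` at switches) and the average-dwell-time condition
`N_σ(s,e) ≤ N₀ + (e−s)/τ_a` with `τ_a > −ln μ / ln(1−α)`, the rate
`λ := (1−α)·μ^{1/τ_a}` satisfies `λ < 1` and
`V_{σ(k)}(x(k)) ≤ μ^{N₀} · λ^k · V_{σ(0)}(x(0))` for every `k`
(global exponential stability). -/
theorem stmt11 {F : Type*} [Fintype F] [DecidableEq F] {E : Type*}
    (σ : ℕ → F) (x : ℕ → E) (V : F → E → ℝ)
    (hV : ∀ i e, 0 ≤ V i e)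
    (α μ : ℝ) (hα : α ∈ Set.Ioo (0 : ℝ) 1) (hμ : 1 < μ)
    (N₀ τa : ℝ) (hN₀ : 0 < N₀)
    (hτa : τa > -(Real.log μ) / Real.log (1 - α))
    (hdecay : ∀ k, V (σ k) (x (k + 1)) ≤ (1 - α) * V (σ k) (x k))
    (hjump : ∀ k, 1 ≤ k → σ k ≠ σ (k - 1) → V (σ k) (x k) ≤ μ * V (σ (k - 1)) (x k))
    (hdwell : ∀ s e : ℕ, s ≤ e → (Nswitch σ s e : ℝ) ≤ N₀ + ((e : ℝ) - (s : ℝ)) / τa) :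
    (1 - α) * μ ^ (1 / τa) < 1 ∧
    ∀ k, V (σ k) (x k) ≤ μ ^ N₀ * ((1 - α) * μ ^ (1 / τa)) ^ k * V (σ 0) (x 0) := by
  obtain ⟨hα0, hα1⟩ := hα
  have h1α : 0 < 1 - α := by linarith
  have hμ0 : 0 < μ := by linarith
  have hlogμ : 0 < Real.log μ := Real.log_pos hμ
  have hlogα : Real.log (1 - α) < 0 := Real.log_neg h1α (by linarith)
  have hτ0 : 0 < τa :=
    lt_trans (div_pos_of_neg_of_neg (by linarith) hlogα) hτa
  have hmul : τa * Real.log (1 - α) < -Real.log μ := (div_lt_iff_of_neg hlogα).1 hτa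
  constructor
  · have hpos : 0 < (1 - α) * μ ^ (1 / τa) := mul_pos h1α (Real.rpow_pos_of_pos hμ0 _)
    rw [← Real.log_neg_iff hpos, Real.log_mul h1α.ne' (Real.rpow_pos_of_pos hμ0 _).ne',
      Real.log_rpow hμ0]
    have h2 : Real.log (1 - α) + 1 / τa * Real.log μ
        = (τa * Real.log (1 - α) + Real.log μ) / τa := by
      field_simp
    rw [h2]
    exact div_neg_of_neg_of_pos (by linarith) hτ0
  · have key : ∀ k, V (σ k) (x k) ≤ μ ^ (Nswitch σ 0 k) * (1 - α) ^ k * V (σ 0) (x 0) := by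
      intro k
      induction k with
      | zero => simp [Nswitch]
      | succ k ih =>
        have hd : V (σ k) (x (k + 1)) ≤
            (1 - α) * (μ ^ (Nswitch σ 0 k) * (1 - α) ^ k * V (σ 0) (x 0)) :=
          (hdecay k).trans (mul_le_mul_of_nonneg_left ih h1α.le)
        have hI : Finset.Ioc 0 (k + 1) = insert (k + 1) (Finset.Ioc 0 k) := by
          ext j
          simp only [Finset.mem_Ioc, Finset.mem_insert]
          omega
        by_cases hs : σ (k + 1) = σ k
        · have hN : Nswitch σ 0 (k + 1) = Nswitch σ 0 k := by
            unfold Nswitch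
            rw [hI, Finset.filter_insert, if_neg (by simpa using hs)]
          rw [hN, hs]
          refine hd.trans (le_of_eq ?_)
          ring
        · have hN : Nswitch σ 0 (k + 1) = Nswitch σ 0 k + 1 := by
            unfold Nswitch
            rw [hI, Finset.filter_insert, if_pos (by simpa using hs),
              Finset.card_insert_of_notMem (by simp)]
          have hj := hjump (k + 1) (by omega) (by simpa using hs)
          rw [Nat.add_sub_cancel] at hj
          rw [hN]
          refine (hj.trans (mul_le_mul_of_nonneg_left hd hμ0.le)).trans (le_of_eq ?_)
          ring
    intro k
    refine (key k).trans (mul_le_mul_of_nonneg_right ?_ (hV _ _))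
    have hN := hdwell 0 k (Nat.zero_le k)
    have hp : μ ^ (Nswitch σ 0 k) ≤ μ ^ N₀ * (μ ^ (1 / τa)) ^ k := by
      rw [← Real.rpow_natCast, ← Real.rpow_natCast (μ ^ (1 / τa)), ← Real.rpow_mul hμ0.le,
        ← Real.rpow_add hμ0]
      apply Real.rpow_le_rpow_of_exponent_le hμ.le
      refine hN.trans (le_of_eq ?_)
      push_cast
      ring
    calc μ ^ (Nswitch σ 0 k) * (1 - α) ^ k
        ≤ μ ^ N₀ * (μ ^ (1 / τa)) ^ k * (1 - α) ^ k :=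
          mul_le_mul_of_nonneg_right hp (pow_nonneg h1α.le k)
      _ = _ := by rw [mul_pow]; ring
end

section
/- Suppose P is a symmetric positive definite d×d matrix such that Ã₀ᵀ P Ã₀ − P + Σ_{i=1}^{L} σᵢ² Ãᵢᵀ P Ãᵢ is negative definite. Then there exists α ∈ (0,1) such that for every positive semidefinite d×d matrix X, trace(P · Γ(X)) ≤ (1−α) · trace(P · X). -/
open Matrix

open scoped MatrixOrder in
lemma exists_factor {d : ℕ} {M : Matrix (Fin d) (Fin d) ℝ} (h : M.PosSemidef) :
    ∃ B : Matrix (Fin d) (Fin d) ℝ, M = Bᵀ * B := by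
  obtain ⟨B, hB⟩ := CStarAlgebra.nonneg_iff_eq_star_mul_self.mp (Matrix.nonneg_iff_posSemidef.mpr h)
  exact ⟨B, by simpa [Matrix.star_eq_conjTranspose, Matrix.conjTranspose_eq_transpose_of_trivial] using hB⟩

lemma trace_sq {d : ℕ} (B : Matrix (Fin d) (Fin d) ℝ) :
    (B * Bᵀ).trace = ∑ i, ∑ k, B i k ^ 2 := by
  simp [Matrix.trace, Matrix.mul_apply, sq]

lemma trace_mul_bounds {d : ℕ} {M Y : Matrix (Fin d) (Fin d) ℝ}
    (hM : M.PosSemidef) (hY : Y.PosSemidef) :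
    0 ≤ (M * Y).trace ∧ (M * Y).trace ≤ M.trace * Y.trace := by
  obtain ⟨B, rfl⟩ := exists_factor hM
  obtain ⟨C, rfl⟩ := exists_factor hY
  have e : (Bᵀ * B * (Cᵀ * C)).trace = ((B * Cᵀ) * (B * Cᵀ)ᵀ).trace := by
    rw [Matrix.transpose_mul, Matrix.transpose_transpose, Matrix.mul_assoc, Matrix.trace_mul_comm]
    simp only [Matrix.mul_assoc]
  rw [e, Matrix.trace_mul_comm Bᵀ, Matrix.trace_mul_comm Cᵀ, trace_sq, trace_sq, trace_sq]
  refine ⟨by positivity, ?_⟩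
  rw [Finset.sum_mul_sum]
  refine Finset.sum_le_sum fun i _ => Finset.sum_le_sum fun j _ => ?_
  rw [Matrix.mul_apply]
  exact Finset.sum_mul_sq_le_sq_mul_sq _ _ _

lemma trace_compare {d : ℕ} {P Q : Matrix (Fin d) (Fin d) ℝ}
    (hP : P.PosSemidef) (hQ : Q.PosDef) :
    ∃ c : ℝ, 0 ≤ c ∧ ∀ X : Matrix (Fin d) (Fin d) ℝ, X.PosSemidef →
      (P * X).trace ≤ c * (Q * X).trace := by
  obtain ⟨S, hS⟩ := exists_factor hQ.posSemidef
  have hdet : IsUnit S.det := by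
    have h := hQ.det_pos
    rw [hS, Matrix.det_mul] at h
    exact isUnit_iff_ne_zero.mpr (right_ne_zero_of_mul h.ne')
  have hM : (S⁻¹ᵀ * P * S⁻¹).PosSemidef := by
    simpa [Matrix.conjTranspose_eq_transpose_of_trivial] using hP.conjTranspose_mul_mul_same S⁻¹
  refine ⟨_, hM.trace_nonneg, fun X hX => ?_⟩
  have hY : (S * X * Sᵀ).PosSemidef := by
    simpa [Matrix.conjTranspose_eq_transpose_of_trivial] using hX.mul_mul_conjTranspose_same S
  have h := (trace_mul_bounds hM hY).2
  have e1 : (S * X * Sᵀ).trace = (Q * X).trace := by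
    rw [hS, Matrix.trace_mul_comm, ← Matrix.mul_assoc]
  have e2 : (S⁻¹ᵀ * P * S⁻¹ * (S * X * Sᵀ)).trace = (P * X).trace := by
    have h1 : S⁻¹ᵀ * P * S⁻¹ * (S * X * Sᵀ) = S⁻¹ᵀ * (P * X * Sᵀ) := by
      rw [Matrix.mul_assoc S, Matrix.mul_assoc _ S⁻¹, Matrix.nonsing_inv_mul_cancel_left _ _ hdet]
      simp only [Matrix.mul_assoc]
    rw [h1, Matrix.trace_mul_comm, Matrix.mul_assoc, ← Matrix.transpose_mul,
      Matrix.nonsing_inv_mul _ hdet, Matrix.transpose_one, Matrix.mul_one]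
  rwa [e1, e2] at h

/-- If `P` is symmetric positive definite and
`Ã₀ᵀ P Ã₀ − P + Σᵢ σᵢ² Ãᵢᵀ P Ãᵢ` is negative definite, then there exists `α ∈ (0,1)`
such that `trace(P·Γ(X)) ≤ (1−α)·trace(P·X)` for every positive semidefinite `X`,
where `Γ(X) = Ã₀ X Ã₀ᵀ + Σᵢ σᵢ² Ãᵢ X Ãᵢᵀ`. -/
theorem stmt12 {d L : ℕ} (hd : 1 ≤ d)
    (A0 : Matrix (Fin d) (Fin d) ℝ) (Amat : Fin L → Matrix (Fin d) (Fin d) ℝ)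
    (σ2 : Fin L → ℝ) (hσ2 : ∀ i, 0 ≤ σ2 i)
    (P : Matrix (Fin d) (Fin d) ℝ) (hP : P.PosDef)
    (hLMI : (-(A0ᵀ * P * A0 - P + ∑ i, σ2 i • ((Amat i)ᵀ * P * Amat i))).PosDef) :
    ∃ α : ℝ, α ∈ Set.Ioo (0 : ℝ) 1 ∧
      ∀ X : Matrix (Fin d) (Fin d) ℝ, X.PosSemidef →
        (P * (A0 * X * A0ᵀ + ∑ i, σ2 i • (Amat i * X * (Amat i)ᵀ))).trace ≤
          (1 - α) * (P * X).trace := by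
  obtain ⟨c, hc, h⟩ := trace_compare hP.posSemidef hLMI
  refine ⟨1 / (c + 2), ⟨by positivity, by rw [div_lt_one (by positivity)]; linarith⟩, fun X hX => ?_⟩
  have h1 := h X hX
  have h0 := (trace_mul_bounds hLMI.posSemidef hX).1
  have cyc : ∀ A : Matrix (Fin d) (Fin d) ℝ, (Aᵀ * P * A * X).trace = (P * (A * X * Aᵀ)).trace := by
    intro A
    rw [Matrix.mul_assoc, Matrix.mul_assoc, Matrix.trace_mul_comm]
    simp only [Matrix.mul_assoc]
  have key : (-(A0ᵀ * P * A0 - P + ∑ i, σ2 i • ((Amat i)ᵀ * P * Amat i)) * X).trace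
      = (P * X).trace - (P * (A0 * X * A0ᵀ + ∑ i, σ2 i • (Amat i * X * (Amat i)ᵀ))).trace := by
    simp only [Matrix.neg_mul, Matrix.add_mul, Matrix.sub_mul, Matrix.mul_add, Matrix.sum_mul,
      Matrix.mul_sum, Matrix.trace_neg, Matrix.trace_add, Matrix.trace_sub, Matrix.trace_sum,
      Matrix.smul_mul, Matrix.mul_smul, Matrix.trace_smul, cyc]
    ring
  rw [key] at h0 h1
  have h2 : 1 / (c + 2) * (P * X).trace ≤
      (P * X).trace - (P * (A0 * X * A0ᵀ + ∑ i, σ2 i • (Amat i * X * (Amat i)ᵀ))).trace := by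
    rw [one_div, inv_mul_le_iff₀ (by positivity)]
    linarith
  linarith
end

section
/- For each mode i ∈ {1, …, N}, let Γ_i be the linear map on real d×d matrices given by Γ_i(X) = Ã₀^{(i)} X (Ã₀^{(i)})ᵀ + Σ_{l=1}^{L} (σ_l^{(i)})² Ã_l^{(i)} X (Ã_l^{(i)})ᵀ, and assume for each i there exists a symmetric positive definite P_i with (Ã₀^{(i)})ᵀ P_i Ã₀^{(i)} − P_i + Σ_{l=1}^{L} (σ_l^{(i)})² (Ã_l^{(i)})ᵀ P_i Ã_l^{(i)} negative definite. Then there exists a positive integer τ_a* such that for every N₀ > 0 and every switching signal σ : ℕ → {1, …, N} having average dwell time τ_a ≥ τ_a* with chatter bound N₀, the switched iteration M(k+1) = Γ_{σ(k)}(M(k)) satisfies M(k) → 0 as k → ∞ for every positive semidefinite initial matrix M(0). -/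
open Matrix Filter

section Helpers
open scoped MatrixOrder Matrix.Norms.L2Operator

theorem psd_entry_le {d : ℕ} {X : Matrix (Fin d) (Fin d) ℝ} (hX : X.PosSemidef) (i j : Fin d) :
    |X i j| ≤ X.trace := by
  have hdiag : ∀ k, 0 ≤ X k k := fun k => hX.diag_nonneg
  have hle : ∀ k, X k k ≤ X.trace := fun k => by
    unfold Matrix.trace
    exact Finset.single_le_sum (f := fun k => X.diag k) (fun k _ => hdiag k) (Finset.mem_univ k)
  have hs : X j i = X i j := by
    have := hX.isHermitian.apply i j
    simpa using this
  have key : ∀ t : ℝ, 0 ≤ X i i + t * X i j + t * X j i + t * t * X j j := by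
    intro t
    have h := hX.dotProduct_mulVec_nonneg (Pi.single i 1 + t • Pi.single j 1)
    simp [Matrix.mulVec_add, Matrix.mulVec_smul, add_dotProduct, dotProduct_add] at h
    linarith
  have h1 := key 1
  have h2 := key (-1)
  have h3 := hle i
  have h4 := hle j
  rw [abs_le]
  constructor <;> linarith

theorem psd_trace_le {d : ℕ} (Q : Matrix (Fin d) (Fin d) ℝ) :
    ∃ C : ℝ, 0 ≤ C ∧ ∀ X : Matrix (Fin d) (Fin d) ℝ, X.PosSemidef →
      (Q * X).trace ≤ C * X.trace := by
  refine ⟨∑ i, ∑ j, |Q i j|, by positivity, fun X hX => ?_⟩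
  simp only [Matrix.trace, Matrix.diag, Matrix.mul_apply]
  rw [Finset.sum_mul]
  refine Finset.sum_le_sum fun i _ => ?_
  rw [Finset.sum_mul]
  refine Finset.sum_le_sum fun j _ => ?_
  refine (le_abs_self _).trans ?_
  rw [abs_mul]
  exact mul_le_mul_of_nonneg_left (psd_entry_le hX j i) (abs_nonneg _)

theorem pd_trace_nonneg {d : ℕ} {P : Matrix (Fin d) (Fin d) ℝ} (hP : P.PosDef)
    {X : Matrix (Fin d) (Fin d) ℝ} (hX : X.PosSemidef) : 0 ≤ (P * X).trace := by
  obtain ⟨B, hB⟩ := CStarAlgebra.nonneg_iff_eq_star_mul_self.mp hP.posSemidef.nonneg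
  have h := (hX.mul_mul_conjTranspose_same B).trace_nonneg
  rw [hB, Matrix.star_eq_conjTranspose, Matrix.mul_assoc, Matrix.trace_mul_comm]
  exact h

theorem pd_trace_le {d : ℕ} {P : Matrix (Fin d) (Fin d) ℝ} (hP : P.PosDef)
    (Q : Matrix (Fin d) (Fin d) ℝ) :
    ∃ C : ℝ, 0 ≤ C ∧ ∀ X : Matrix (Fin d) (Fin d) ℝ, X.PosSemidef →
      (Q * X).trace ≤ C * (P * X).trace := by
  obtain ⟨B, hB⟩ := CStarAlgebra.nonneg_iff_eq_star_mul_self.mp hP.posSemidef.nonneg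
  have hdet : IsUnit B.det := by
    have h := hP.det_pos
    rw [hB, Matrix.det_mul] at h
    exact isUnit_iff_ne_zero.mpr (right_ne_zero_of_mul h.ne')
  have hinv : B⁻¹ * B = 1 := Matrix.nonsing_inv_mul _ hdet
  obtain ⟨C, hC, h⟩ := psd_trace_le ((B⁻¹)ᴴ * Q * B⁻¹)
  refine ⟨C, hC, fun X hX => ?_⟩
  have h1 := h _ (hX.mul_mul_conjTranspose_same B)
  have h2 : (P * X).trace = (B * X * Bᴴ).trace := by
    rw [hB, Matrix.star_eq_conjTranspose, Matrix.mul_assoc, Matrix.trace_mul_comm]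
  have h3 : ((B⁻¹)ᴴ * Q * B⁻¹ * (B * X * Bᴴ)).trace = (Q * X).trace := by
    have e : (B⁻¹)ᴴ * Q * B⁻¹ * (B * X * Bᴴ) = (B⁻¹)ᴴ * (Q * (B⁻¹ * B) * X * Bᴴ) := by
      simp only [Matrix.mul_assoc]
    have e2 : Bᴴ * (B⁻¹)ᴴ = 1 := by
      rw [← Matrix.conjTranspose_mul, hinv, Matrix.conjTranspose_one]
    rw [e, Matrix.trace_mul_comm, hinv, Matrix.mul_one, Matrix.mul_assoc, e2, Matrix.mul_one]
  rw [h2, ← h3]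
  exact h1

theorem exists_tau (C l : ℝ) (hC : 2 ≤ C) (hl0 : 0 < l) (hl : l < 1) :
    ∃ n : ℕ, 0 < n ∧ C ^ (1 / (n : ℝ)) * l < 1 := by
  have hll : Real.log l < 0 := Real.log_neg hl0 hl
  obtain ⟨n, hn⟩ := exists_nat_gt (Real.log C / (-Real.log l))
  have hCl : 0 < Real.log C := Real.log_pos (by linarith)
  have hn0 : (0 : ℝ) < n := lt_trans (div_pos hCl (by linarith)) hn
  refine ⟨n, by exact_mod_cast hn0, ?_⟩
  have hC0 : 0 < C := by linarith
  have hp : 0 < C ^ (1 / (n : ℝ)) * l := mul_pos (Real.rpow_pos_of_pos hC0 _) hl0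
  rw [← Real.log_neg_iff hp, Real.log_mul (Real.rpow_pos_of_pos hC0 _).ne' hl0.ne',
    Real.log_rpow hC0]
  rw [div_lt_iff₀ (by linarith)] at hn
  have : 1 / (n : ℝ) * Real.log C < - Real.log l := by
    rw [one_div, inv_mul_lt_iff₀ hn0]; exact hn
  linarith

theorem Nswitch_succ {F : Type*} [DecidableEq F] (σ : ℕ → F) (k : ℕ) :
    Nswitch σ 0 (k + 1) = Nswitch σ 0 k + if σ (k + 1) ≠ σ k then 1 else 0 := by
  unfold Nswitch
  rw [← Finset.insert_Ioc_right_eq_Ioc_add_one (Nat.zero_le k), Finset.filter_insert]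
  split_ifs with h1 h2 h2
  · rw [Finset.card_insert_of_notMem (by simp)]
  · simp at h1; exact absurd h1 h2
  · simp at h1; exact absurd h1 h2
  · rfl

end Helpers

/-- If every mode `i` of the switched state-correlation dynamics
`M(k+1) = Γ_{σ(k)}(M(k))`, with
`Γ_i(X) = Ã₀⁽ⁱ⁾ X (Ã₀⁽ⁱ⁾)ᵀ + Σ_l (σ_l⁽ⁱ⁾)² Ã_l⁽ⁱ⁾ X (Ã_l⁽ⁱ⁾)ᵀ`, satisfies the
mean-square-stability LMI, then there is a positive integer `τ_a*` such that for every
chatter bound `N₀ > 0` and every switching signal with average dwell time `τ_a ≥ τ_a*`,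
the iteration converges to `0` from every positive semidefinite initial matrix. -/
theorem stmt14 {d N L : ℕ}
    (A0 : Fin N → Matrix (Fin d) (Fin d) ℝ)
    (Amat : Fin N → Fin L → Matrix (Fin d) (Fin d) ℝ)
    (σ2 : Fin N → Fin L → ℝ) (hσ2 : ∀ i l, 0 ≤ σ2 i l)
    (hLMI : ∀ i, ∃ P : Matrix (Fin d) (Fin d) ℝ, P.PosDef ∧
      (-((A0 i)ᵀ * P * A0 i - P + ∑ l, σ2 i l • ((Amat i l)ᵀ * P * Amat i l))).PosDef) :
    ∃ τstar : ℕ, 0 < τstar ∧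
      ∀ N₀ : ℝ, 0 < N₀ → ∀ τa : ℝ, (τstar : ℝ) ≤ τa →
        ∀ σ : ℕ → Fin N,
          (∀ s e : ℕ, s ≤ e → (Nswitch σ s e : ℝ) ≤ N₀ + ((e : ℝ) - (s : ℝ)) / τa) →
          ∀ M : ℕ → Matrix (Fin d) (Fin d) ℝ, (M 0).PosSemidef →
            (∀ k, M (k + 1) =
              A0 (σ k) * M k * (A0 (σ k))ᵀ
                + ∑ l, σ2 (σ k) l • (Amat (σ k) l * M k * (Amat (σ k) l)ᵀ)) →
            Tendsto M atTop (nhds 0) := by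
  choose P hP hR using hLMI
  choose C1 hC1 hC1' using fun i j => pd_trace_le (hP i) (P j)
  choose C2 hC2 hC2' using fun i => pd_trace_le (hR i) (P i)
  choose C3 hC3 hC3' using fun i => pd_trace_le (hP i) (1 : Matrix (Fin d) (Fin d) ℝ)
  set C : ℝ := 2 + ∑ i, ∑ j, C1 i j + ∑ i, C2 i + ∑ i, C3 i with hCdef
  have s1 : 0 ≤ ∑ i, ∑ j, C1 i j :=
    Finset.sum_nonneg fun i _ => Finset.sum_nonneg fun j _ => hC1 i j
  have s2 : 0 ≤ ∑ i, C2 i := Finset.sum_nonneg fun i _ => hC2 i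
  have s3 : 0 ≤ ∑ i, C3 i := Finset.sum_nonneg fun i _ => hC3 i
  have t1 : ∀ i j, C1 i j ≤ C := fun i j => by
    have a := Finset.single_le_sum (f := fun j => C1 i j) (fun j _ => hC1 i j) (Finset.mem_univ j)
    have b := Finset.single_le_sum (f := fun i => ∑ j, C1 i j)
      (fun i _ => Finset.sum_nonneg fun j _ => hC1 i j) (Finset.mem_univ i)
    linarith
  have t2 : ∀ i, C2 i ≤ C := fun i => by
    have a := Finset.single_le_sum (f := C2) (fun j _ => hC2 j) (Finset.mem_univ i)
    linarith
  have t3 : ∀ i, C3 i ≤ C := fun i => by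
    have a := Finset.single_le_sum (f := C3) (fun j _ => hC3 j) (Finset.mem_univ i)
    linarith
  have hC : 2 ≤ C := by linarith
  have hC0 : 0 < C := by linarith
  clear_value C
  have hCi : 0 < C⁻¹ := by positivity
  have hCi' : C⁻¹ ≤ 2⁻¹ := inv_anti₀ (by norm_num) hC
  obtain ⟨l, hl⟩ : ∃ l, l = 1 - C⁻¹ := ⟨_, rfl⟩
  have hl0 : 0 < l := by rw [hl]; norm_num at hCi' ⊢; linarith
  have hl1 : l < 1 := by linarith
  obtain ⟨n, hn, hnl⟩ := exists_tau C l hC hl0 hl1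
  refine ⟨n, hn, ?_⟩
  intro N₀ hN₀ τa hτ σ hσ M hM0 hM
  have hn0 : (0 : ℝ) < n := by exact_mod_cast hn
  have hτ0 : 0 < τa := lt_of_lt_of_le hn0 hτ
  have hpsd : ∀ k, (M k).PosSemidef := by
    intro k
    induction k with
    | zero => exact hM0
    | succ k ih =>
      rw [hM k]
      refine Matrix.PosSemidef.add ?_ (Matrix.posSemidef_sum _ fun l _ => ?_)
      · have := ih.mul_mul_conjTranspose_same (A0 (σ k))
        rwa [Matrix.conjTranspose_eq_transpose_of_trivial] at this
      · have := ih.mul_mul_conjTranspose_same (Amat (σ k) l)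
        rw [Matrix.conjTranspose_eq_transpose_of_trivial] at this
        exact this.smul (hσ2 _ _)
  have hdec : ∀ k, (P (σ k) * M (k + 1)).trace ≤ l * (P (σ k) * M k).trace := by
    intro k
    have cyc : ∀ (Q A X : Matrix (Fin d) (Fin d) ℝ),
        (Q * (A * X * Aᵀ)).trace = (Aᵀ * Q * A * X).trace := by
      intro Q A X
      rw [← Matrix.mul_assoc, Matrix.trace_mul_comm]
      simp only [Matrix.mul_assoc]
    have h1 := hC2' (σ k) (M k) (hpsd k)
    have hr := pd_trace_nonneg (hR (σ k)) (hpsd k)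
    have h2 := h1.trans (mul_le_mul_of_nonneg_right (t2 (σ k)) hr)
    have h3 : (P (σ k) * M (k + 1)).trace = (P (σ k) * M k).trace -
        (-((A0 (σ k))ᵀ * P (σ k) * A0 (σ k) - P (σ k) + ∑ l, σ2 (σ k) l • ((Amat (σ k) l)ᵀ * P (σ k) * Amat (σ k) l)) * M k).trace := by
      rw [hM k]
      simp only [Matrix.mul_add, Matrix.add_mul, Matrix.sub_mul, Matrix.neg_mul, Matrix.mul_sum,
        Matrix.sum_mul, Matrix.trace_add, Matrix.trace_sub, Matrix.trace_neg, Matrix.trace_sum,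
        Matrix.mul_smul, Matrix.smul_mul, Matrix.trace_smul, cyc]
      ring
    rw [h3]
    rw [← inv_mul_le_iff₀ hC0] at h2
    rw [hl]
    linarith
  have hW0 : ∀ k, 0 ≤ (P (σ k) * M k).trace := fun k => pd_trace_nonneg (hP _) (hpsd k)
  have hW : ∀ k, (P (σ k) * M k).trace ≤ C ^ (Nswitch σ 0 k) * l ^ k * (P (σ 0) * M 0).trace := by
    intro k
    induction k with
    | zero => simp [Nswitch]
    | succ k ih =>
      rw [Nswitch_succ]
      have h1 := (hdec k).trans (mul_le_mul_of_nonneg_left ih hl0.le)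
      split_ifs with h
      · have h2 := hC1' (σ k) (σ (k+1)) _ (hpsd (k+1))
        have h3 := h2.trans (mul_le_mul_of_nonneg_right (t1 _ _) (pd_trace_nonneg (hP _) (hpsd (k+1))))
        refine (h3.trans (mul_le_mul_of_nonneg_left h1 hC0.le)).trans (le_of_eq ?_)
        ring
      · push Not at h
        rw [h]
        refine h1.trans (le_of_eq ?_)
        ring
  set q := C ^ (1 / (n : ℝ)) * l with hq
  have hq0 : 0 ≤ q := mul_nonneg (Real.rpow_nonneg hC0.le _) hl0.le
  have hW2 : ∀ k, (P (σ k) * M k).trace ≤ C ^ N₀ * q ^ k * (P (σ 0) * M 0).trace := by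
    intro k
    refine (hW k).trans (mul_le_mul_of_nonneg_right ?_ (hW0 0))
    have h1 := hσ 0 k (Nat.zero_le k)
    have h2 : (Nswitch σ 0 k : ℝ) ≤ N₀ + 1 / (n : ℝ) * k := by
      refine h1.trans ?_
      have : (k : ℝ) / τa ≤ k / n := div_le_div_of_nonneg_left (Nat.cast_nonneg k) hn0 hτ
      simp only [Nat.cast_zero, sub_zero]
      calc _ ≤ N₀ + (k : ℝ) / n := by linarith
        _ = _ := by ring
    have h3 : C ^ (Nswitch σ 0 k) ≤ C ^ N₀ * (C ^ (1 / (n : ℝ))) ^ k := by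
      rw [← Real.rpow_natCast, ← Real.rpow_natCast, ← Real.rpow_mul hC0.le, ← Real.rpow_add hC0]
      exact Real.rpow_le_rpow_of_exponent_le (by linarith) h2
    rw [hq, mul_pow, ← mul_assoc]
    exact mul_le_mul_of_nonneg_right h3 (pow_nonneg hl0.le _)
  have hlim : Tendsto (fun k => C * (C ^ N₀ * q ^ k * (P (σ 0) * M 0).trace)) atTop (nhds 0) := by
    have := (((tendsto_pow_atTop_nhds_zero_of_lt_one hq0 hnl).const_mul (C ^ N₀)).mul_const
      ((P (σ 0) * M 0).trace)).const_mul C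
    simpa using this
  refine tendsto_pi_nhds.mpr ?_
  intro i
  refine tendsto_pi_nhds.mpr ?_
  intro j
  refine squeeze_zero_norm (fun k => ?_) hlim
  rw [Real.norm_eq_abs]
  refine (psd_entry_le (hpsd k) i j).trans ?_
  have h1 := hC3' (σ k) _ (hpsd k)
  rw [Matrix.one_mul] at h1
  exact (h1.trans (mul_le_mul_of_nonneg_right (t3 _) (hW0 k))).trans
    (mul_le_mul_of_nonneg_left (hW2 k) hC0.le)
end
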